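/- Let P be an admissible polytope. Then Q(P) ∩ C⁺ = P ∩ C⁺, and Q(P) = (P ∩ C⁺) + cone(−α₁,…,−α_l), where cone(−α₁,…,−α_l) = {Σᵢ tᵢ(−αᵢ) : tᵢ ∈ ℝ, tᵢ ≥ 0} and + denotes Minkowski sum. -/

import Mathlib

open scoped RealInnerProductSpace Pointwise

/-- The orthogonal reflection `s_α` in the hyperplane orthogonal to `α`:
`s_α (x) = x − ⟨x, α^∨⟩ α` where `α^∨ = 2α/⟨α,α⟩`. -/
noncomputable def reflVec {V : Type*} [NormedAddCommGroup V] [InnerProductSpace ℝ V]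
    (α x : V) : V :=
  x - (2 * ⟪x, α⟫ / ⟪α, α⟫) • α

/-- A reduced crystallographic root system `Φ` spanning `V`, together with a fixed base
`α₁, …, α_l` of simple roots. -/
structure RootSystemWithBase (V : Type*) [NormedAddCommGroup V] [InnerProductSpace ℝ V]
    [FiniteDimensional ℝ V] (l : ℕ) where
  Φ : Set V
  finite : Φ.Finite
  spans : Submodule.span ℝ Φ = ⊤
  nz : ∀ α ∈ Φ, α ≠ 0
  reflMem : ∀ α ∈ Φ, ∀ β ∈ Φ, reflVec α β ∈ Φ
  cryst : ∀ α ∈ Φ, ∀ β ∈ Φ, ∃ n : ℤ, (n : ℝ) = 2 * ⟪β, α⟫ / ⟪α, α⟫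
  reduced : ∀ α ∈ Φ, ∀ t : ℝ, t • α ∈ Φ → t = 1 ∨ t = -1
  simple : Fin l → V
  simpleMem : ∀ i, simple i ∈ Φ
  indep : LinearIndependent ℝ simple
  base : ∀ β ∈ Φ, (∃ c : Fin l → ℝ, (∀ i, 0 ≤ c i) ∧ β = ∑ i, c i • simple i) ∨
      (∃ c : Fin l → ℝ, (∀ i, c i ≤ 0) ∧ β = ∑ i, c i • simple i)

namespace RootSystemWithBase

variable {V : Type*} [NormedAddCommGroup V] [InnerProductSpace ℝ V] [FiniteDimensional ℝ V]
variable {l : ℕ} (R : RootSystemWithBase V l)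

/-- The root lattice `M`, the ℤ-span of the roots. -/
def rootLattice : Submodule ℤ V := Submodule.span ℤ R.Φ

/-- The weight lattice `Λ = {x ∈ V : ⟨x, α^∨⟩ ∈ ℤ for all α ∈ Φ}`. -/
def weightLattice : Set V :=
  {x | ∀ α ∈ R.Φ, ∃ n : ℤ, (n : ℝ) = 2 * ⟪x, α⟫ / ⟪α, α⟫}

/-- The closed dominant chamber `C⁺`. -/
def domChamber : Set V := {x | ∀ i, 0 ≤ ⟪x, R.simple i⟫}

/-- The wall `H_j = {x : ⟨x, α_j⟩ = 0}`. -/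
def wall (j : Fin l) : Set V := {x | ⟪x, R.simple j⟫ = 0}

/-- Invariance under the Weyl group `W` (equivalently, invariance under each of the
generating reflections `s_α`, `α ∈ Φ`). -/
def WInvariant (P : Set V) : Prop := ∀ α ∈ R.Φ, ∀ x ∈ P, reflVec α x ∈ P

/-- `Q(P) = {m : ⟨m,u⟩ ≥ min_{p∈P} ⟨p,u⟩ for every u with ⟨α_i,u⟩ ≤ 0 for all i}`;
since the minimum over the (compact) polytope `P` is attained, `⟨m,u⟩ ≥ min_{p∈P}⟨p,u⟩`
is expressed as `∃ p ∈ P, ⟨p,u⟩ ≤ ⟨m,u⟩`. -/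
def Q (P : Set V) : Set V :=
  {m | ∀ u : V, (∀ i, ⟪R.simple i, u⟫ ≤ 0) → ∃ p ∈ P, ⟪p, u⟫ ≤ ⟪m, u⟫}

/-- An admissible polytope: a `W`-invariant polytope all of whose vertices lie in the
weight lattice and none of whose vertices lies on a wall. -/
def IsAdmissible (P : Set V) : Prop :=
  (∃ S : Set V, S.Finite ∧ S.Nonempty ∧ P = convexHull ℝ S) ∧
  R.WInvariant P ∧
  (∀ v ∈ P.extremePoints ℝ, v ∈ R.weightLattice) ∧
  ∀ j : Fin l, ∀ v ∈ P.extremePoints ℝ, v ∉ R.wall j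

end RootSystemWithBase

theorem inner_reflVec_left {V : Type*} [NormedAddCommGroup V] [InnerProductSpace ℝ V]
    (α x y : V) : ⟪reflVec α x, y⟫ = ⟪x, reflVec α y⟫ := by
  simp only [reflVec, inner_sub_left, inner_sub_right, inner_smul_left, inner_smul_right,
    RCLike.conj_to_real]
  rw [real_inner_comm y α]
  ring

theorem norm_reflVec {V : Type*} [NormedAddCommGroup V] [InnerProductSpace ℝ V]
    (α x : V) : ‖reflVec α x‖ = ‖x‖ := by
  rcases eq_or_ne α 0 with rfl | hα
  · simp [reflVec]
  have hα' : ⟪α, α⟫ ≠ 0 := by simpa using hα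
  rw [← sq_eq_sq₀ (norm_nonneg _) (norm_nonneg _), ← real_inner_self_eq_norm_sq,
    ← real_inner_self_eq_norm_sq]
  simp only [reflVec, inner_sub_left, inner_sub_right, inner_smul_left, inner_smul_right,
    RCLike.conj_to_real]
  rw [real_inner_comm x α]
  field_simp
  ring

namespace RootSystemWithBase

variable {V : Type*} [NormedAddCommGroup V] [InnerProductSpace ℝ V] [FiniteDimensional ℝ V]
variable {l : ℕ} (R : RootSystemWithBase V l)

theorem top_le_span_simple : ⊤ ≤ Submodule.span ℝ (Set.range R.simple) := by
  rw [← R.spans, Submodule.span_le]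
  intro β hβ
  rcases R.base β hβ with ⟨c, -, rfl⟩ | ⟨c, -, rfl⟩ <;>
    exact Submodule.sum_mem _ fun i _ =>
      Submodule.smul_mem _ _ (Submodule.subset_span ⟨i, rfl⟩)

/-- The basis of `V` consisting of the simple roots. -/
noncomputable def simpleBasis : Module.Basis (Fin l) ℝ V :=
  Module.Basis.mk R.indep R.top_le_span_simple

@[simp]
theorem simpleBasis_apply (i : Fin l) : R.simpleBasis i = R.simple i := by
  simp [simpleBasis]

theorem sum_coord_smul_simple (x : V) : ∑ i, R.simpleBasis.coord i x • R.simple i = x := by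
  simpa using R.simpleBasis.sum_repr x

/-- The cone spanned by the simple roots, described by nonnegativity of the coordinates. -/
def posCone : Set V := {x | ∀ i, 0 ≤ R.simpleBasis.coord i x}

theorem isClosed_posCone : IsClosed R.posCone := by
  simp only [posCone, Set.ofPred_forall]
  exact isClosed_iInter fun i =>
    isClosed_le continuous_const (R.simpleBasis.coord i).continuous_of_finiteDimensional

theorem convex_posCone : Convex ℝ R.posCone := by
  intro x hx y hy a b ha hb _ i
  have := add_nonneg (mul_nonneg ha (hx i)) (mul_nonneg hb (hy i))
  simpa using this

theorem add_mem_posCone {x y : V} (hx : x ∈ R.posCone) (hy : y ∈ R.posCone) :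
    x + y ∈ R.posCone := by
  intro i
  simpa using add_nonneg (hx i) (hy i)

theorem smul_simple_mem_posCone {t : ℝ} (ht : 0 ≤ t) (i : Fin l) :
    t • R.simple i ∈ R.posCone := by
  intro j
  rw [← R.simpleBasis_apply, map_smul, Module.Basis.coord_apply, Module.Basis.repr_self,
    smul_eq_mul, Finsupp.single_apply]
  split_ifs <;> simp [ht]

theorem inner_nonneg_of_mem_posCone {x u : V} (hx : x ∈ R.posCone)
    (hu : u ∈ R.domChamber) : 0 ≤ ⟪u, x⟫ := by
  rw [← R.sum_coord_smul_simple x, inner_sum]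
  refine Finset.sum_nonneg fun i _ => ?_
  rw [inner_smul_right]
  exact mul_nonneg (hx i) (hu i)

theorem setOf_neg_cone_eq :
    {x : V | ∃ t : Fin l → ℝ, (∀ i, 0 ≤ t i) ∧ x = ∑ i, t i • (-(R.simple i))} =
      -R.posCone := by
  ext x
  simp only [smul_neg, Finset.sum_neg_distrib, Set.mem_ofPred_eq, Set.mem_neg]
  constructor
  · rintro ⟨t, ht, rfl⟩
    rw [neg_neg]
    intro j
    rw [map_sum]
    exact Finset.sum_nonneg fun i _ => R.smul_simple_mem_posCone (ht i) i j
  · intro hx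
    exact ⟨fun i => R.simpleBasis.coord i (-x), hx, by rw [R.sum_coord_smul_simple, neg_neg]⟩

/-- Every point of a compact set stable under the simple reflections is dominated by a point of
the set lying in the dominant chamber. -/
theorem exists_mem_domChamber_sub_mem_posCone {K : Set V} (hK : IsCompact K)
    (hinv : ∀ i, ∀ y ∈ K, reflVec (R.simple i) y ∈ K) {x : V} (hx : x ∈ K) :
    ∃ y ∈ K, y ∈ R.domChamber ∧ y - x ∈ R.posCone := by
  let f : V →ₗ[ℝ] ℝ := ∑ i, R.simpleBasis.coord i
  have hf : ∀ i, f (R.simple i) = 1 := fun i => by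
    rw [← R.simpleBasis_apply]
    simp only [f, LinearMap.sum_apply, Module.Basis.coord_apply, Module.Basis.repr_self]
    simp [Finsupp.single_apply]
  have hcl : IsClosed {y | y - x ∈ R.posCone} :=
    R.isClosed_posCone.preimage (continuous_id.sub continuous_const)
  obtain ⟨y, ⟨hyK, hyx⟩, hmax⟩ := (hK.inter_right hcl).exists_isMaxOn
    ⟨x, hx, fun i => by simp⟩ f.continuous_of_finiteDimensional.continuousOn
  refine ⟨y, hyK, fun i => ?_, hyx⟩
  by_contra! hneg
  have hpos : 0 < ⟪R.simple i, R.simple i⟫ :=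
    real_inner_self_pos.2 (R.nz _ (R.simpleMem i))
  set t := -(2 * ⟪y, R.simple i⟫ / ⟪R.simple i, R.simple i⟫) with ht
  have htpos : 0 < t := neg_pos.2 (div_neg_of_neg_of_pos (by linarith) hpos)
  have hrefl : reflVec (R.simple i) y = y + t • R.simple i := by
    rw [reflVec, ht, neg_smul, sub_eq_add_neg]
  have hmem : y + t • R.simple i ∈ K ∩ {y | y - x ∈ R.posCone} := by
    refine ⟨hrefl ▸ hinv i y hyK, ?_⟩
    have := R.add_mem_posCone hyx (R.smul_simple_mem_posCone htpos.le i)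
    rwa [sub_add_eq_add_sub] at this
  have hle : f (y + t • R.simple i) ≤ f y := hmax hmem
  rw [map_add, map_smul, hf, smul_eq_mul, mul_one] at hle
  linarith

theorem exists_le_inner_of_mem_Q {P : Set V} {m w : V} (hm : m ∈ R.Q P)
    (hw : w ∈ R.domChamber) : ∃ p ∈ P, ⟪m, w⟫ ≤ ⟪p, w⟫ := by
  obtain ⟨p, hp, h⟩ := hm (-w) fun i => by
    rw [inner_neg_right, real_inner_comm]
    exact neg_nonpos.2 (hw i)
  exact ⟨p, hp, by simpa using h⟩

theorem subset_Q_of_add_neg_posCone (P : Set V) : P + -R.posCone ⊆ R.Q P := by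
  rintro _ ⟨p, hp, c, hc, rfl⟩ u hu
  have h := R.inner_nonneg_of_mem_posCone (u := -u) hc fun i => by
    rw [inner_neg_left, real_inner_comm]
    exact neg_nonneg.2 (hu i)
  refine ⟨p, hp, ?_⟩
  rw [inner_neg_neg, real_inner_comm] at h
  simpa [inner_add_left] using h

theorem exists_inner_separation {D : Set V} (hD : Convex ℝ D) (hcl : IsClosed D) {m : V}
    (hm : m ∉ D) : ∃ (w : V) (c : ℝ), (∀ d ∈ D, ⟪d, w⟫ ≤ c) ∧ c < ⟪m, w⟫ := by
  obtain ⟨f, c, hf, hc⟩ := geometric_hahn_banach_closed_point hD hcl hm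
  refine ⟨(InnerProductSpace.toDual ℝ V).symm f, c, fun d hd => ?_, ?_⟩
  · rw [real_inner_comm, InnerProductSpace.toDual_symm_apply]
    exact (hf d hd).le
  · rwa [real_inner_comm, InnerProductSpace.toDual_symm_apply]

theorem Q_eq_add_neg_posCone {P : Set V} (hPc : IsCompact P) (hPne : P.Nonempty)
    (hPconv : Convex ℝ P) : R.Q P = P + -R.posCone := by
  refine Set.Subset.antisymm (fun m hm => ?_) (R.subset_Q_of_add_neg_posCone P)
  by_contra hmD
  obtain ⟨w, c, hD, hc⟩ := exists_inner_separation (hPconv.add R.convex_posCone.neg)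
    (R.isClosed_posCone.neg.add_left_of_isCompact hPc) hmD
  have hmul : ∀ p ∈ P, ∀ i, ∀ t : ℝ, 0 ≤ t → ⟪p, w⟫ - t * ⟪w, R.simple i⟫ ≤ c := by
    intro p hp i t ht
    have := hD (p + -(t • R.simple i))
      (Set.add_mem_add hp (Set.neg_mem_neg.2 (R.smul_simple_mem_posCone ht i)))
    rwa [inner_add_left, inner_neg_left, real_inner_smul_left, ← sub_eq_add_neg,
      real_inner_comm w (R.simple i)] at this
  have hw : w ∈ R.domChamber := by
    intro i
    by_contra! hneg
    obtain ⟨p, hp⟩ := hPne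
    have h0 := hmul p hp i 0 le_rfl
    have h1 := hmul p hp i ((c - ⟪p, w⟫ + 1) / -⟪w, R.simple i⟫)
      (div_nonneg (by linarith) (by linarith))
    rw [div_neg, neg_mul, div_mul_cancel₀ _ hneg.ne] at h1
    linarith
  obtain ⟨p, hp, hle⟩ := R.exists_le_inner_of_mem_Q hm hw
  have := hD p ⟨p, hp, 0, fun i => by simp, add_zero p⟩
  linarith

theorem Q_inter_domChamber_subset {P : Set V} (hPcl : IsClosed P) (hPconv : Convex ℝ P)
    (hinv : R.WInvariant P) : R.Q P ∩ R.domChamber ⊆ P := by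
  rintro m ⟨hmQ, hmdom⟩
  by_contra hmP
  obtain ⟨w, c, hP, hc⟩ := exists_inner_separation hPconv hPcl hmP
  have hcl : IsClosed {y : V | ∀ p ∈ P, ⟪p, y⟫ ≤ c} := by
    simp only [Set.ofPred_forall]
    exact isClosed_biInter fun p _ =>
      isClosed_le (continuous_const.inner continuous_id) continuous_const
  obtain ⟨y, ⟨-, hy⟩, hydom, hyw⟩ := R.exists_mem_domChamber_sub_mem_posCone
    ((isCompact_closedBall (0 : V) ‖w‖).inter_right hcl)
    (fun i y hy => ⟨by simpa [norm_reflVec] using hy.1, fun p hp => by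
      rw [← inner_reflVec_left]
      exact hy.2 _ (hinv _ (R.simpleMem i) p hp)⟩)
    (⟨by simp, hP⟩ : w ∈ Metric.closedBall (0 : V) ‖w‖ ∩ {y : V | ∀ p ∈ P, ⟪p, y⟫ ≤ c})
  obtain ⟨p, hp, hle⟩ := R.exists_le_inner_of_mem_Q hmQ hydom
  have h1 := R.inner_nonneg_of_mem_posCone hyw hmdom
  rw [inner_sub_right] at h1
  have h2 := hy p hp
  linarith

end RootSystemWithBase

/-- for an admissible polytope `P`, `Q(P) ∩ C⁺ = P ∩ C⁺` and
`Q(P) = (P ∩ C⁺) + cone(−α₁,…,−α_l)`. -/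
theorem stmt1 {V : Type*} [NormedAddCommGroup V] [InnerProductSpace ℝ V]
    [FiniteDimensional ℝ V] {l : ℕ} (R : RootSystemWithBase V l)
    (P : Set V) (hP : R.IsAdmissible P) :
    R.Q P ∩ R.domChamber = P ∩ R.domChamber ∧
    R.Q P = (P ∩ R.domChamber) +
      {x : V | ∃ t : Fin l → ℝ, (∀ i, 0 ≤ t i) ∧ x = ∑ i, t i • (-(R.simple i))} := by
  obtain ⟨⟨S, hSfin, hSne, rfl⟩, hinv, -, -⟩ := hP
  set P := convexHull ℝ S
  have hPc : IsCompact P := hSfin.isCompact_convexHull ℝ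
  have hPne : P.Nonempty := hSne.convexHull
  have hPconv : Convex ℝ P := convex_convexHull ℝ S
  have hQ := R.Q_eq_add_neg_posCone hPc hPne hPconv
  refine ⟨Set.Subset.antisymm
    (Set.subset_inter (R.Q_inter_domChamber_subset hPc.isClosed hPconv hinv)
      Set.inter_subset_right)
    (Set.inter_subset_inter_left _ fun p hp _ _ => ⟨p, hp, le_rfl⟩), ?_⟩
  rw [R.setOf_neg_cone_eq, hQ]
  refine Set.Subset.antisymm ?_ (Set.add_subset_add_right Set.inter_subset_left)
  rintro _ ⟨p, hp, c, hc, rfl⟩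
  obtain ⟨y, hyP, hydom, hyp⟩ := R.exists_mem_domChamber_sub_mem_posCone hPc
    (fun i => hinv _ (R.simpleMem i)) hp
  refine ⟨y, ⟨hyP, hydom⟩, c - (y - p), ?_, by simp only; abel⟩
  have := R.add_mem_posCone (Set.mem_neg.1 hc) hyp
  rwa [Set.mem_neg, neg_sub, sub_eq_neg_add]
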